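/- There is a unique A-module isomorphism Φ from the algebraic dual (V ⊗_A W₀)^* onto L_A(W, V₀^*) such that Φ(u)(w)(b·v) = u(v ⊗ (b·w)) for all u ∈ (V ⊗_A W₀)^*, w ∈ W, b ∈ B and v ∈ V. -/

import Mathlib

open scoped TensorProduct

variable (K A : Type*) [Field K] [CommRing A] [Algebra K A]

/-- Scalar multiplication by `a : A` as a `K`-linear map on an `A`-module. -/
def smulKLinear (M : Type*) [AddCommGroup M] [Module A M] [Module K M] [IsScalarTower K A M]
    (a : A) : M →ₗ[K] M where
  toFun m := a • m
  map_add' := smul_add a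
  map_smul' k m := (smul_comm k a m).symm

/-- The algebraic dual `M^* = Hom_K(M, K)` of an `A`-module `M` is an `A`-module via the
adjoint action `(a • f) m := f (a • m)`. -/
instance dualModule (M : Type*) [AddCommGroup M] [Module A M] [Module K M]
    [IsScalarTower K A M] : Module A (Module.Dual K M) where
  smul a f := f ∘ₗ smulKLinear K A M a
  one_smul f := LinearMap.ext fun m => by
    show f ((1 : A) • m) = f m
    rw [one_smul]
  mul_smul a b f := LinearMap.ext fun m => by
    show f ((a * b) • m) = f (b • a • m)
    rw [← mul_smul, mul_comm]
  smul_zero a := LinearMap.ext fun _ => rfl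
  smul_add a f g := LinearMap.ext fun _ => rfl
  add_smul a b f := LinearMap.ext fun m => by
    show f ((a + b) • m) = f (a • m) + f (b • m)
    rw [add_smul, map_add]
  zero_smul f := LinearMap.ext fun m => by
    show f ((0 : A) • m) = 0
    rw [zero_smul, map_zero]

/-- local units act on `B ⊗ M`. -/
theorem aux_unit {A : Type*} [CommRing A] (M : Type*) [AddCommGroup M] [Module A M] (B : Ideal A)
    (hB : ∀ b₁ ∈ B, ∀ b₂ ∈ B, ∃ c ∈ B, c * b₁ = b₁ ∧ c * b₂ = b₂) (t : B ⊗[A] M) :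
    ∃ c ∈ B, c • t = t := by
  induction t with
  | zero => exact ⟨0, B.zero_mem, by simp⟩
  | tmul b m =>
    obtain ⟨c, hc, h, -⟩ := hB b b.2 b b.2
    refine ⟨c, hc, ?_⟩
    rw [TensorProduct.smul_tmul']
    congr 1
    exact Subtype.ext h
  | add x y hx hy =>
    obtain ⟨c, hc, h⟩ := hx
    obtain ⟨d, hd, h'⟩ := hy
    obtain ⟨e, he, h1, h2⟩ := hB c hc d hd
    refine ⟨e, he, ?_⟩
    rw [smul_add, ← h, ← h', smul_smul, smul_smul, h1, h2]

/-- multiplication `B ⊗ M → B M`. -/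
def auxMul {A : Type*} [CommRing A] (M : Type*) [AddCommGroup M] [Module A M] (B : Ideal A) :
    B ⊗[A] M →ₗ[A] ↥(B • (⊤ : Submodule A M)) :=
  TensorProduct.lift (LinearMap.mk₂ A
    (fun b m => ⟨(b : A) • m, Submodule.smul_mem_smul b.2 Submodule.mem_top⟩)
    (fun _ _ _ => Subtype.ext (add_smul _ _ _))
    (fun _ _ _ => Subtype.ext (mul_smul _ _ _))
    (fun _ _ _ => Subtype.ext (smul_add _ _ _))
    (fun _ _ _ => Subtype.ext (smul_comm _ _ _)))

theorem auxMul_tmul {A : Type*} [CommRing A] (M : Type*) [AddCommGroup M] [Module A M]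
    (B : Ideal A) (b : B) (m : M) : auxMul M B (b ⊗ₜ m) =
      ⟨(b : A) • m, Submodule.smul_mem_smul b.2 Submodule.mem_top⟩ := rfl

theorem auxMul_key {A : Type*} [CommRing A] (M : Type*) [AddCommGroup M] [Module A M]
    (B : Ideal A) (c : A) (hc : c ∈ B) (t : B ⊗[A] M) :
    c • t = (⟨c, hc⟩ : B) ⊗ₜ[A] (auxMul M B t : M) := by
  induction t with
  | zero => simp
  | tmul b m =>
    rw [auxMul_tmul, ← TensorProduct.smul_tmul, TensorProduct.smul_tmul']
    congr 1
    exact Subtype.ext (mul_comm _ _)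
  | add x y hx hy =>
    rw [smul_add, hx, hy, map_add, Submodule.coe_add, TensorProduct.tmul_add]

theorem auxMul_bij {A : Type*} [CommRing A] (M : Type*) [AddCommGroup M] [Module A M] (B : Ideal A)
    (hB : ∀ b₁ ∈ B, ∀ b₂ ∈ B, ∃ c ∈ B, c * b₁ = b₁ ∧ c * b₂ = b₂) :
    Function.Bijective (auxMul M B) := by
  constructor
  · rw [injective_iff_map_eq_zero]
    intro t ht
    obtain ⟨c, hc, h⟩ := aux_unit M B hB t
    rw [← h, auxMul_key M B c hc, ht]
    simp
  · rintro ⟨x, hx⟩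
    suffices h : ∃ t, (auxMul M B t : M) = x by
      obtain ⟨t, ht⟩ := h
      exact ⟨t, Subtype.ext ht⟩
    refine Submodule.smul_induction_on hx ?_ ?_
    · intro b hb m _
      exact ⟨(⟨b, hb⟩ : B) ⊗ₜ m, rfl⟩
    · rintro x y ⟨s, rfl⟩ ⟨t, rfl⟩
      exact ⟨s + t, by simp⟩

/-- `V₀ ⊗ W ≃ V ⊗ W₀`. -/
theorem aux_equiv {A : Type*} [CommRing A] (V W : Type*) [AddCommGroup V] [Module A V]
    [AddCommGroup W] [Module A W] (B : Ideal A)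
    (hB : ∀ b₁ ∈ B, ∀ b₂ ∈ B, ∃ c ∈ B, c * b₁ = b₁ ∧ c * b₂ = b₂) :
    ∃ e : ↥(B • (⊤ : Submodule A V)) ⊗[A] W ≃ₗ[A] V ⊗[A] ↥(B • (⊤ : Submodule A W)),
      ∀ (b : A) (hb : b ∈ B) (v : V) (w : W),
        e ((⟨b • v, Submodule.smul_mem_smul hb Submodule.mem_top⟩ :
            ↥(B • (⊤ : Submodule A V))) ⊗ₜ w) =
          v ⊗ₜ ⟨b • w, Submodule.smul_mem_smul hb Submodule.mem_top⟩ := by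
  let eV := LinearEquiv.ofBijective _ (auxMul_bij V B hB)
  let eW := LinearEquiv.ofBijective _ (auxMul_bij W B hB)
  refine ⟨(TensorProduct.congr eV.symm (LinearEquiv.refl A W)).trans
    ((TensorProduct.congr (TensorProduct.comm A B V) (LinearEquiv.refl A W)).trans
    ((TensorProduct.assoc A V B W).trans (TensorProduct.congr (LinearEquiv.refl A V) eW))), ?_⟩
  intro b hb v w
  have h : eV.symm ⟨b • v, Submodule.smul_mem_smul hb Submodule.mem_top⟩ =
      (⟨b, hb⟩ : B) ⊗ₜ v := by
    rw [LinearEquiv.symm_apply_eq]; rfl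
  simp only [LinearEquiv.trans_apply, TensorProduct.congr_tmul, h, TensorProduct.comm_tmul,
    TensorProduct.assoc_tmul, LinearEquiv.refl_apply]
  rfl

/-- Let `B` be an ideal of `A` such that for any `b₁, b₂ ∈ B` there exists `c ∈ B` with
`c * b₁ = b₁` and `c * b₂ = b₂`, and let `V₀ := B • V`, `W₀ := B • W`.  There is a unique
`A`-module isomorphism `Φ : (V ⊗[A] W₀)^* ≃ L_A(W, V₀^*)` such that
`Φ u w (b • v) = u (v ⊗ (b • w))` for all `u`, `w ∈ W`, `b ∈ B` and `v ∈ V`. -/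
theorem statement9 (V W : Type*)
    [AddCommGroup V] [Module A V] [Module K V] [IsScalarTower K A V]
    [AddCommGroup W] [Module A W] [Module K W] [IsScalarTower K A W]
    (B : Ideal A)
    (hB : ∀ b₁ ∈ B, ∀ b₂ ∈ B, ∃ c ∈ B, c * b₁ = b₁ ∧ c * b₂ = b₂) :
    ∃! Φ : Module.Dual K (V ⊗[A] ↥(B • (⊤ : Submodule A W))) ≃ₗ[A]
        (W →ₗ[A] Module.Dual K ↥(B • (⊤ : Submodule A V))),
      ∀ (u : Module.Dual K (V ⊗[A] ↥(B • (⊤ : Submodule A W))))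
        (w : W) (b : A) (hb : b ∈ B) (v : V),
        Φ u w ⟨b • v, Submodule.smul_mem_smul hb Submodule.mem_top⟩ =
          u (v ⊗ₜ[A]
            (⟨b • w, Submodule.smul_mem_smul hb Submodule.mem_top⟩ :
              ↥(B • (⊤ : Submodule A W)))) := by
  obtain ⟨e, he⟩ := aux_equiv V W B hB
  have eK : ∀ (k : K) t, e (k • t) = k • e t := fun k t => by
    rw [← algebraMap_smul A k t, map_smul, algebraMap_smul]
  have eK' : ∀ (k : K) t, e.symm (k • t) = k • e.symm t := fun k t => by
    rw [← algebraMap_smul A k t, map_smul, algebraMap_smul]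
  let F : Module.Dual K (V ⊗[A] ↥(B • (⊤ : Submodule A W))) →ₗ[A]
        (W →ₗ[A] Module.Dual K ↥(B • (⊤ : Submodule A V))) :=
    { toFun := fun u =>
        { toFun := fun w =>
            { toFun := fun x => u (e (x ⊗ₜ w))
              map_add' := fun x y => by rw [TensorProduct.add_tmul, map_add, map_add]
              map_smul' := fun k x => by
                rw [← TensorProduct.smul_tmul', eK, map_smul]; rfl }
          map_add' := fun w w' => LinearMap.ext fun x => by
            show u (e (x ⊗ₜ (w + w'))) = u (e (x ⊗ₜ w)) + u (e (x ⊗ₜ w'))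
            rw [TensorProduct.tmul_add, map_add, map_add]
          map_smul' := fun a w => LinearMap.ext fun x => by
            show u (e (x ⊗ₜ (a • w))) = u (e ((a • x) ⊗ₜ w))
            rw [TensorProduct.smul_tmul] }
      map_add' := fun u u' => rfl
      map_smul' := fun a u => LinearMap.ext fun w => LinearMap.ext fun x => by
        show u (a • e (x ⊗ₜ w)) = u (e ((a • x) ⊗ₜ w))
        rw [← TensorProduct.smul_tmul', map_smul e] }
  have hF : ∀ u w x, F u w x = u (e (x ⊗ₜ w)) := fun _ _ _ => rfl
  have hbij : Function.Bijective F := by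
    constructor
    · intro u u' h
      have h2 : ∀ t, u (e t) = u' (e t) := by
        intro t
        induction t with
        | zero => simp
        | tmul x w => rw [← hF, ← hF, h]
        | add x y hx hy => rw [map_add, map_add, map_add, hx, hy]
      refine LinearMap.ext fun s => ?_
      simpa using h2 (e.symm s)
    · intro φ
      let g : ↥(B • (⊤ : Submodule A V)) ⊗[A] W →+ K :=
        TensorProduct.liftAddHom
          { toFun := fun x =>
              { toFun := fun w => φ w x
                map_zero' := by rw [map_zero]; rfl
                map_add' := fun w w' => by rw [map_add]; rfl }
            map_zero' := by ext w; exact map_zero (φ w)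
            map_add' := fun x y => by ext w; exact map_add (φ w) x y }
          (fun a x w => by
            show φ w (a • x) = φ (a • w) x
            rw [LinearMap.map_smul φ a w]; rfl)
      have hg : ∀ x w, g (x ⊗ₜ w) = φ w x := fun _ _ => rfl
      have gK : ∀ (k : K) t, g (k • t) = k • g t := by
        intro k t
        induction t with
        | zero => simp
        | tmul x w => rw [TensorProduct.smul_tmul', hg, hg, map_smul]
        | add x y hx hy => rw [smul_add, map_add, map_add, hx, hy, smul_add]
      refine ⟨{ toFun := fun s => g (e.symm s)
                map_add' := fun s t => by rw [map_add, map_add]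
                map_smul' := fun k s => by rw [eK', gK]; rfl }, ?_⟩
      refine LinearMap.ext fun w => LinearMap.ext fun x => ?_
      rw [hF]
      show g (e.symm (e (x ⊗ₜ w))) = φ w x
      rw [e.symm_apply_apply, hg]
  refine ⟨LinearEquiv.ofBijective F hbij, ?_, ?_⟩
  · intro u w b hb v
    exact congrArg u (he b hb v w)
  · intro Ψ hΨ
    refine LinearEquiv.ext fun u => LinearMap.ext fun w => LinearMap.ext fun x => ?_
    obtain ⟨t, rfl⟩ := (auxMul_bij V B hB).2 x
    induction t with
    | zero => simp
    | tmul b v =>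
      exact (hΨ u w b b.2 v).trans (congrArg u (he b b.2 v w)).symm
    | add x y hx hy => rw [map_add, map_add, map_add, hx, hy]
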